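/- Structure of the wave equation for the metric difference: let d ≥ 1, λ ∈ (0,1], η ∈ (0,1], V ⊆ ℝ^(d+1) open, and let g_0, g_λ be metrics on V with h := g_λ − g_0; set H^α := H^α(g_λ)(∂g_λ) and H_0^α := H^α(g_0)(∂g_0). Suppose Ric(g_λ) = 0 pointwise on V, and that C1 ≥ 1 with, pointwise on V: |(g_0)_αβ|, |g_0^αβ|, |∂g_0|, |∂²g_0| ≤ C1; |(g_λ)_αβ|, |g_λ^αβ|, |∂g_λ| ≤ C1 and |∂²g_λ| ≤ C1 λ^(−1); |h_αβ| ≤ C1 λ; |H^α − H_0^α| ≤ C1 λ^η and |∂_γ H^α| ≤ C1 for all indices. Then there exists C2 depending only on C1 and d such that pointwise on V, for all μ, ν: |Box_{g_0} h_μν − 2 Ric_μν(g_0) − g_0^αα' g_0^ββ' h_α'β' ∂²_αβ h_μν − L_μν(g_0)(∂h) − Q_μν(g_0)(∂h, ∂h) − P_μν(g_0)(∂h, ∂h) − 2 (g_0)_α(μ ∂_ν) (H^α − H_0^α)| ≤ C2 λ^η, where Box_{g_0} h_μν := g_0^αβ ∂²_αβ h_μν − H_0^α ∂_α h_μν. 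-/

import Mathlib

noncomputable section

open MeasureTheory Filter Topology
open scoped ENNReal NNReal

abbrev Vec (d : ℕ) := Fin (d + 1) → ℝ
abbrev SymMat (d : ℕ) := Vec d → Matrix (Fin (d + 1)) (Fin (d + 1)) ℝ
abbrev Met (d : ℕ) := SymMat d
abbrev Phase (d : ℕ) := Vec d × Vec d

/-- Coordinate partial derivative `∂_α`. -/
def pd {d : ℕ} {E : Type*} [NormedAddCommGroup E] [NormedSpace ℝ E]
    (α : Fin (d + 1)) (f : Vec d → E) (x : Vec d) : E :=
  fderiv ℝ f x (Pi.single α 1)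

/-- Entries of the pointwise inverse matrix `g^{αβ}`. -/
def ginv {d : ℕ} (g : Met d) (x : Vec d) : Matrix (Fin (d + 1)) (Fin (d + 1)) ℝ := (g x)⁻¹

/-- Minkowski matrix `diag(-1,1,…,1)`. -/
def mink (d : ℕ) : Matrix (Fin (d + 1)) (Fin (d + 1)) ℝ :=
  Matrix.diagonal (fun α => if α = 0 then (-1 : ℝ) else 1)

/-- A metric on V : smooth entries, symmetric and invertible pointwise on V. -/
def IsMetricOn {d : ℕ} (g : Met d) (V : Set (Vec d)) : Prop :=
  (∀ α β, ContDiffOn ℝ (⊤ : ℕ∞) (fun x => g x α β) V) ∧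
  (∀ x ∈ V, (g x).IsSymm) ∧ (∀ x ∈ V, IsUnit (g x).det)

/-- Christoffel symbol `Γ_{αβμ}(g)`. -/
def Christoffel {d : ℕ} (g : Met d) (α β μ : Fin (d + 1)) (x : Vec d) : ℝ :=
  (1 / 2) * (pd α (fun y => g y μ β) x + pd μ (fun y => g y α β) x - pd β (fun y => g y α μ) x)

/-- Mixed Christoffel symbol `Γ_ρ{}^α{}_μ(g)`. -/
def GammaMix {d : ℕ} (g : Met d) (ρ α μ : Fin (d + 1)) (x : Vec d) : ℝ :=
  ∑ β, ginv g x α β * Christoffel g ρ β μ x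

/-- Coordinate formula for the Ricci curvature. -/
def RicciC {d : ℕ} (g : Met d) (μ ν : Fin (d + 1)) (x : Vec d) : ℝ :=
  (∑ α, ∑ β, ginv g x α β * (pd β (Christoffel g μ α ν) x - pd ν (Christoffel g μ α β) x)) +
  ∑ α, ∑ β, ∑ σ, ∑ ρ, ginv g x α β * ginv g x σ ρ *
    (Christoffel g ν σ α x * Christoffel g μ ρ β x -
      Christoffel g α σ β x * Christoffel g μ ρ ν x)

/-- `H^ρ(g)(∂p)`. -/
def Hgauge {d : ℕ} (g : Met d) (p : SymMat d) (ρ : Fin (d + 1)) (x : Vec d) : ℝ :=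
  ∑ σ, ∑ α, ∑ β, ginv g x ρ σ * ginv g x α β *
    (pd β (fun y => p y σ α) x - (1 / 2) * pd σ (fun y => p y α β) x)

/-- Scalar wave operator `Box_g f = g^{αβ} ∂²_{αβ} f − H^α(g)(∂g) ∂_α f`. -/
def BoxOp {d : ℕ} {E : Type*} [NormedAddCommGroup E] [NormedSpace ℝ E]
    (g : Met d) (f : Vec d → E) (x : Vec d) : E :=
  (∑ α, ∑ β, ginv g x α β • pd α (pd β f) x) - ∑ α, Hgauge g g α x • pd α f x

/-- Fourier transform on `ℝ^n` with the convention `∫ f(x) e^{-i x·ξ} dx`. -/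
def ft {n : ℕ} (f : (Fin n → ℝ) → ℂ) (ξ : Fin n → ℝ) : ℂ :=
  ∫ x : Fin n → ℝ, f x * Complex.exp (-Complex.I * (∑ i, x i * ξ i))

/-- Inverse Fourier transform on `ℝ^n`. -/
def ftInv {n : ℕ} (f : (Fin n → ℝ) → ℂ) (x : Fin n → ℝ) : ℂ :=
  ((((2 * Real.pi) ^ n)⁻¹ : ℝ) : ℂ) *
    ∫ ξ : Fin n → ℝ, f ξ * Complex.exp (Complex.I * (∑ i, x i * ξ i))

/-- Fourier multiplier operator `T_m u = F^{-1}(m · F u)`. -/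
def Tm {n : ℕ} (m : (Fin n → ℝ) → ℝ) (u : (Fin n → ℝ) → ℂ) : (Fin n → ℝ) → ℂ :=
  ftInv (fun ξ => (m ξ : ℂ) * ft u ξ)

/-- Pairing `⟨u,v⟩ = ∫ conj(u) v √|det g| dx`. -/
def pairG {d : ℕ} (g : Met d) (u v : Vec d → ℂ) : ℂ :=
  ∫ x : Vec d, (starRingEnd ℂ) (u x) * v x * ((Real.sqrt |(g x).det| : ℝ) : ℂ)

/-- `m` is smooth away from `0` and positively `0`-homogeneous. -/
def Homog0 {n : ℕ} (m : (Fin n → ℝ) → ℝ) : Prop :=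
  ContDiffOn ℝ (⊤ : ℕ∞) m {(0 : Fin n → ℝ)}ᶜ ∧ ∀ s : ℝ, 0 < s → ∀ ξ, m (s • ξ) = m ξ

/-- Integral of a function against a (finite) signed measure. -/
def sInt {X : Type*} [MeasurableSpace X] (μ : MeasureTheory.SignedMeasure X) (f : X → ℝ) : ℝ :=
  (∫ x, f x ∂μ.toJordanDecomposition.posPart) -
    ∫ x, f x ∂μ.toJordanDecomposition.negPart

/-- Unit sphere `S^d ⊂ ℝ^{d+1}`. -/
def usphere (d : ℕ) : Set (Vec d) := {ξ | ∑ α, ξ α ^ 2 = 1}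

/-- Integral against `dμ := g_0^{αρ} g_0^{βσ} ((1/4) dμ_{ρβασ} − (1/8) dμ_{ραβσ})`. -/
def muInt {d : ℕ} (g0 : Met d)
    (μm : Fin (d + 1) → Fin (d + 1) → Fin (d + 1) → Fin (d + 1) →
      MeasureTheory.SignedMeasure (Phase d))
    (c : Phase d → ℝ) : ℝ :=
  ∑ α, ∑ β, ∑ ρ, ∑ σ,
    ((1 / 4) * sInt (μm ρ β α σ) (fun p => ginv g0 p.1 α ρ * ginv g0 p.1 β σ * c p) -
     (1 / 8) * sInt (μm ρ α β σ) (fun p => ginv g0 p.1 α ρ * ginv g0 p.1 β σ * c p))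

/-- `∂_{x^μ}` on phase space. -/
def pdx {d : ℕ} (μ : Fin (d + 1)) (F : Phase d → ℝ) (p : Phase d) : ℝ :=
  fderiv ℝ F p (Pi.single μ 1, 0)

/-- `∂_{ξ_μ}` on phase space. -/
def pdxi {d : ℕ} (μ : Fin (d + 1)) (F : Phase d → ℝ) (p : Phase d) : ℝ :=
  fderiv ℝ F p (0, Pi.single μ 1)

/-- `g_0^{μν} ξ_μ ξ_ν` as a function on phase space. -/
def Gq {d : ℕ} (g0 : Met d) (p : Phase d) : ℝ := ∑ μ, ∑ ν, ginv g0 p.1 μ ν * p.2 μ * p.2 ν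

/-- Poisson bracket `{F,G} = ∂_{ξ_μ}F ∂_{x^μ}G − ∂_{x^μ}F ∂_{ξ_μ}G`. -/
def pbracket {d : ℕ} (F G : Phase d → ℝ) (p : Phase d) : ℝ :=
  ∑ μ, (pdxi μ F p * pdx μ G p - pdx μ F p * pdxi μ G p)

/-- The `X^p_λ(g)` norm. -/
def XNorm {d : ℕ} (p : ℝ≥0∞) (lam : ℝ) (g : Met d) (f : Vec d → ℂ) : ℝ :=
  lam⁻¹ * (eLpNorm f p volume).toReal +
  (∑ α, (eLpNorm (pd α f) p volume).toReal) +
  lam * (∑ α, ∑ β, (eLpNorm (pd α (pd β f)) p volume).toReal) +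
  (eLpNorm (BoxOp g f) p volume).toReal

/-- Null form `𝔔_0^{(g)}` (complex-valued). -/
def Q0C {d : ℕ} (g : Met d) (φ ψ : Vec d → ℂ) (x : Vec d) : ℂ :=
  ∑ α, ∑ β, ((ginv g x α β : ℝ) : ℂ) * pd α φ x * pd β ψ x

/-- Null form `𝔔_{μν}` (complex-valued). -/
def QmnC {d : ℕ} (μ ν : Fin (d + 1)) (φ ψ : Vec d → ℂ) (x : Vec d) : ℂ :=
  pd μ φ x * pd ν ψ x - pd ν φ x * pd μ ψ x

/-- Null form `𝔔_0^{(g)}` (real-valued). -/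
def Q0R {d : ℕ} (g : Met d) (φ ψ : Vec d → ℝ) (x : Vec d) : ℝ :=
  ∑ α, ∑ β, ginv g x α β * pd α φ x * pd β ψ x

/-- Null form `𝔔_{μν}` (real-valued). -/
def QmnR {d : ℕ} (μ ν : Fin (d + 1)) (φ ψ : Vec d → ℝ) (x : Vec d) : ℝ :=
  pd μ φ x * pd ν ψ x - pd ν φ x * pd μ ψ x

/-- The quadratic form `B_{μν}(g)(∂p, ∂q)` (symmetrizations written out). -/
def Bq {d : ℕ} (g : Met d) (p q : SymMat d) (μ ν : Fin (d + 1)) (x : Vec d) : ℝ :=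
  ∑ α, ∑ β, ∑ σ, ∑ ρ, ginv g x α β * ginv g x σ ρ *
    ((pd μ (fun y => p y β ρ) x * pd σ (fun y => q y ν α) x +
      pd ν (fun y => p y β ρ) x * pd σ (fun y => q y μ α) x) -
     (1 / 4) * (pd μ (fun y => p y β ρ) x * pd ν (fun y => q y α σ) x +
                pd ν (fun y => p y β ρ) x * pd μ (fun y => q y α σ) x) +
     pd σ (fun y => p y ν α) x * pd ρ (fun y => q y μ β) x -
     pd α (fun y => p y ν σ) x * pd ρ (fun y => q y μ β) x)

/-- `D_μ^{ασ}(g_0)`. -/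
def Dcoef {d : ℕ} (g0 : Met d) (μ α σ : Fin (d + 1)) (x : Vec d) : ℝ :=
  ∑ β, ∑ ρ, ginv g0 x α β * ginv g0 x σ ρ *
    (2 * pd ρ (fun y => g0 y β μ) x - pd μ (fun y => g0 y β ρ) x)

/-- `L_{μν}(g_0)(∂h)`. -/
def Lq {d : ℕ} (g0 : Met d) (h : SymMat d) (μ ν : Fin (d + 1)) (x : Vec d) : ℝ :=
  2 * (∑ σ, ∑ ρ, ∑ α, ginv g0 x σ ρ *
        (GammaMix g0 ρ α μ x * pd σ (fun y => h y ν α) x +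
         GammaMix g0 ρ α ν x * pd σ (fun y => h y μ α) x)) +
  (1 / 2) * (∑ α, ∑ σ, (Dcoef g0 μ α σ x * pd ν (fun y => h y α σ) x +
                        Dcoef g0 ν α σ x * pd μ (fun y => h y α σ) x))

/-- `Q_{μν}(g_0)(∂h, ∂h)`. -/
def Qq {d : ℕ} (g0 : Met d) (h : SymMat d) (μ ν : Fin (d + 1)) (x : Vec d) : ℝ :=
  (∑ α, ∑ β, ginv g0 x α β * Q0R g0 (fun y => h y ν α) (fun y => h y μ β) x) +
  ∑ α, ∑ β, ∑ σ, ∑ ρ, ginv g0 x α β * ginv g0 x σ ρ *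
    ((1 / 2) * (QmnR β μ (fun y => h y σ ρ) (fun y => h y ν α) x +
                QmnR β ν (fun y => h y σ ρ) (fun y => h y μ α) x) +
     (QmnR μ σ (fun y => h y β ρ) (fun y => h y ν α) x +
      QmnR ν σ (fun y => h y β ρ) (fun y => h y μ α) x) -
     QmnR α ρ (fun y => h y ν σ) (fun y => h y μ β) x)

/-- `P_{μν}(g_0)(∂h, ∂h)`. -/
def Pq {d : ℕ} (g0 : Met d) (h : SymMat d) (μ ν : Fin (d + 1)) (x : Vec d) : ℝ :=
  (1 / 4) * (∑ α, ∑ α', ginv g0 x α α' * pd μ (fun y => h y α α') x) *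
            (∑ β, ∑ β', ginv g0 x β β' * pd ν (fun y => h y β β') x) -
  (1 / 2) * ∑ α, ∑ α', ∑ β, ∑ β', ginv g0 x α α' * pd μ (fun y => h y α β) x *
            ginv g0 x β β' * pd ν (fun y => h y α' β') x

/-- Euclidean norm on `ℝ^n`. -/
def enormV {n : ℕ} (ξ : Fin n → ℝ) : ℝ := Real.sqrt (∑ i, ξ i ^ 2)

/-- The angle quantity `Ξ_{ι1 ι2}(θ,η)`. -/
def XiAng (ι1 ι2 : ℝ) (θ η : Fin 3 → ℝ) : ℝ :=
  Real.sqrt (2 * (enormV θ * enormV η - ι1 * ι2 * ∑ i, θ i * η i) / (enormV θ * enormV η))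

/-- The phase `Φ_{ι ι1 ι2}(ξ,η)`. -/
def PhiPh (ι ι1 ι2 : ℝ) (ξ η : Fin 3 → ℝ) : ℝ :=
  ι * enormV ξ - ι1 * enormV (ξ - η) - ι2 * enormV η

/-- Littlewood–Paley projection on `ℝ³` built from `ψLP`. -/
def LPProj (ψLP : (Fin 3 → ℝ) → ℝ) (k : ℤ) (f : (Fin 3 → ℝ) → ℂ) : (Fin 3 → ℝ) → ℂ :=
  ftInv (fun ξ => (ψLP ((2 : ℝ) ^ (-k) • ξ) : ℂ) * ft f ξ)

/-- A standard Littlewood–Paley bump. -/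
def GoodLP (ψLP : (Fin 3 → ℝ) → ℝ) : Prop :=
  ContDiff ℝ (⊤ : ℕ∞) ψLP ∧ (∀ ξ, ψLP ξ ∈ Set.Icc (0 : ℝ) 1) ∧
  (∀ ξ ζ, enormV ξ = enormV ζ → ψLP ξ = ψLP ζ) ∧
  (Function.support ψLP ⊆ {ξ | 1 / 2 ≤ enormV ξ ∧ enormV ξ ≤ 2}) ∧
  (∀ ξ : Fin 3 → ℝ, ξ ≠ 0 → ∑' k : ℤ, ψLP ((2 : ℝ) ^ (-k) • ξ) = 1)

/-- Admissible symbols of Ionescu–Pausader type. -/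
def AdmSymbol (m : (Fin 3 → ℝ) → (Fin 3 → ℝ) → ℝ) : Prop :=
  (∃ i j : Fin 3, ∀ θ η, m θ η = (θ i * η j - θ j * η i) / (enormV θ * enormV η)) ∨
  (∃ j : Fin 3, ∀ θ η, m θ η = η j / enormV η - θ j / enormV θ)

/-- Spatial part of a spacetime point. -/
def spat (x : Vec 3) : Fin 3 → ℝ := fun i => x i.succ

/-- Reassemble a spacetime point from its time and space parts. -/
def glue (t : ℝ) (y : Fin 3 → ℝ) : Vec 3 := Fin.cons t y

/-- Spatial Littlewood–Paley projection on `ℝ^{1+3}`. -/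
def LPsp (ψLP : (Fin 3 → ℝ) → ℝ) (k : ℤ) (u : Vec 3 → ℂ) (x : Vec 3) : ℂ :=
  ftInv (fun ξ => (ψLP ((2 : ℝ) ^ (-k) • ξ) : ℂ) * ft (fun y => u (glue (x 0) y)) ξ) (spat x)

/-- Minkowski wave operator on `ℝ^{1+3}`. -/
def BoxMink (u : Vec 3 → ℂ) (x : Vec 3) : ℂ :=
  - pd 0 (pd 0 u) x + ∑ i : Fin 3, pd i.succ (pd i.succ u) x

/-- Flat pairing `⟨u,v⟩ = ∫ conj(u) v`. -/
def pairF (u v : Vec 3 → ℂ) : ℂ := ∫ x : Vec 3, (starRingEnd ℂ) (u x) * v x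

/-- `Σ_α ‖∂_α φ‖_{L^p}`. -/
def dNorm (p : ℝ≥0∞) (φ : Vec 3 → ℂ) : ℝ := ∑ α, (eLpNorm (pd α φ) p volume).toReal

/-- Covector `dt − 𝔞_i dx^i`. -/
def cov1 (af : Fin 3 → Vec 3 → ℝ) (x : Vec 3) : Fin (3 + 1) → ℝ :=
  Fin.cons 1 (fun i => - af i x)

/-- Covector `dx^i + 𝔟^i dt + 𝔅^i_j dx^j`. -/
def cov2 (bf : Fin 3 → Vec 3 → ℝ) (Bf : Fin 3 → Fin 3 → Vec 3 → ℝ) (i : Fin 3) (x : Vec 3) :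
    Fin (3 + 1) → ℝ :=
  Fin.cons (bf i x) (fun j => (if j = i then (1 : ℝ) else 0) + Bf i j x)

/-- Matrix of the quadratic form `−𝔑 (dt − 𝔞_i dx^i)² + Σ_i 𝔠_i (dx^i + 𝔟^i dt + 𝔅^i_j dx^j)²`. -/
def met4 (Nf : Vec 3 → ℝ) (af bf cf : Fin 3 → Vec 3 → ℝ) (Bf : Fin 3 → Fin 3 → Vec 3 → ℝ) :
    Met 3 :=
  fun x => Matrix.of fun α β =>
    - Nf x * cov1 af x α * cov1 af x β + ∑ i, cf i x * cov2 bf Bf i x α * cov2 bf Bf i x β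

section Algebra

variable {ι : Type*} [Fintype ι]

/-- Full contraction of a four-index array against `G ⊗ G`. -/
def contr₂ (G : Matrix ι ι ℝ) (Φ : ι → ι → ι → ι → ℝ) : ℝ :=
  ∑ α, ∑ β, ∑ σ, ∑ ρ, G α β * G σ ρ * Φ α β σ ρ

variable {G : Matrix ι ι ℝ}

theorem contr₂_add (Φ Ψ : ι → ι → ι → ι → ℝ) :
    contr₂ G (fun α β σ ρ => Φ α β σ ρ + Ψ α β σ ρ) = contr₂ G Φ + contr₂ G Ψ := by
  simp only [contr₂, mul_add, Finset.sum_add_distrib]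

theorem contr₂_sub (Φ Ψ : ι → ι → ι → ι → ℝ) :
    contr₂ G (fun α β σ ρ => Φ α β σ ρ - Ψ α β σ ρ) = contr₂ G Φ - contr₂ G Ψ := by
  simp only [contr₂, mul_sub, Finset.sum_sub_distrib]

theorem contr₂_const_mul (c : ℝ) (Φ : ι → ι → ι → ι → ℝ) :
    contr₂ G (fun α β σ ρ => c * Φ α β σ ρ) = c * contr₂ G Φ := by
  simp only [contr₂, Finset.mul_sum]
  refine Finset.sum_congr rfl fun _ _ => Finset.sum_congr rfl fun _ _ =>
    Finset.sum_congr rfl fun _ _ => Finset.sum_congr rfl fun _ _ => by ring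

theorem contr₂_swap_left (hG : ∀ a b, G a b = G b a) (Φ : ι → ι → ι → ι → ℝ) :
    contr₂ G (fun α β σ ρ => Φ β α σ ρ) = contr₂ G Φ := by
  unfold contr₂
  rw [Finset.sum_comm]
  simp only [hG]

theorem contr₂_swap_right (hG : ∀ a b, G a b = G b a) (Φ : ι → ι → ι → ι → ℝ) :
    contr₂ G (fun α β σ ρ => Φ α β ρ σ) = contr₂ G Φ := by
  unfold contr₂
  refine Finset.sum_congr rfl fun α _ => Finset.sum_congr rfl fun β _ => ?_
  rw [Finset.sum_comm]
  refine Finset.sum_congr rfl fun σ _ => Finset.sum_congr rfl fun ρ _ => ?_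
  rw [hG ρ σ]

theorem contr₂_swap_pairs (Φ : ι → ι → ι → ι → ℝ) :
    contr₂ G (fun α β σ ρ => Φ σ ρ α β) = contr₂ G Φ := by
  have key : ∀ F : ι → ι → ι → ι → ℝ, ∑ α, ∑ β, ∑ σ, ∑ ρ, F α β σ ρ =
      ∑ p : ι × ι, ∑ q : ι × ι, F p.1 p.2 q.1 q.2 := fun F => by
    simp only [Fintype.sum_prod_type]
  unfold contr₂
  rw [key, key, Finset.sum_comm]
  refine Finset.sum_congr rfl fun p _ => Finset.sum_congr rfl fun q _ => ?_
  ring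

/-- An array whose symmetrization over the symmetries of `G ⊗ G` vanishes has zero contraction. -/
theorem contr₂_eq_zero (hG : ∀ a b, G a b = G b a) {Φ : ι → ι → ι → ι → ℝ}
    (h : ∀ α β σ ρ, Φ α β σ ρ + Φ β α σ ρ + Φ α β ρ σ + Φ β α ρ σ +
      Φ σ ρ α β + Φ ρ σ α β + Φ σ ρ β α + Φ ρ σ β α = 0) : contr₂ G Φ = 0 := by
  have h0 : contr₂ G (fun α β σ ρ => Φ α β σ ρ + Φ β α σ ρ + Φ α β ρ σ + Φ β α ρ σ +
      Φ σ ρ α β + Φ ρ σ α β + Φ σ ρ β α + Φ ρ σ β α) = 0 := by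
    simp only [h, contr₂, mul_zero, Finset.sum_const_zero]
  simp only [contr₂_add] at h0
  have e1 := contr₂_swap_left hG Φ
  have e2 := contr₂_swap_right hG Φ
  have e3 := contr₂_swap_left hG (fun α β σ ρ => Φ α β ρ σ)
  have e4 := contr₂_swap_pairs (G := G) Φ
  have e5 := contr₂_swap_right hG (fun α β σ ρ => Φ σ ρ α β)
  have e6 := contr₂_swap_left hG (fun α β σ ρ => Φ σ ρ α β)
  have e7 := contr₂_swap_left hG (fun α β σ ρ => Φ ρ σ α β)
  linarith

/-- Full contraction of a two-index array against `G`. -/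
def contr₁ (G : Matrix ι ι ℝ) (T : ι → ι → ℝ) : ℝ := ∑ α, ∑ β, G α β * T α β

theorem contr₁_add (T U : ι → ι → ℝ) :
    contr₁ G (fun α β => T α β + U α β) = contr₁ G T + contr₁ G U := by
  simp only [contr₁, mul_add, Finset.sum_add_distrib]

theorem contr₁_sub (T U : ι → ι → ℝ) :
    contr₁ G (fun α β => T α β - U α β) = contr₁ G T - contr₁ G U := by
  simp only [contr₁, mul_sub, Finset.sum_sub_distrib]

theorem contr₁_const_mul (c : ℝ) (T : ι → ι → ℝ) :
    contr₁ G (fun α β => c * T α β) = c * contr₁ G T := by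
  simp only [contr₁, Finset.mul_sum]
  exact Finset.sum_congr rfl fun _ _ => Finset.sum_congr rfl fun _ _ => by ring

/-- An antisymmetric array has zero contraction against a symmetric one. -/
theorem contr₁_eq_zero (hG : ∀ a b, G a b = G b a) {T : ι → ι → ℝ}
    (h : ∀ α β, T α β + T β α = 0) : contr₁ G T = 0 := by
  have h1 : contr₁ G T = contr₁ G (fun α β => T β α) := by
    unfold contr₁
    rw [Finset.sum_comm]
    simp only [hG]
  have h2 : contr₁ G T + contr₁ G (fun α β => T β α) = 0 := by
    rw [← contr₁_add]
    simp only [h, contr₁, mul_zero, Finset.sum_const_zero]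
  linarith

/-- Christoffel symbol built from an array of first derivatives. -/
def chr (D : ι → ι → ι → ℝ) (α β μ : ι) : ℝ :=
  (1 / 2) * (D α μ β + D μ α β - D β α μ)

/-- The array whose `G`-trace over the last two indices is the lowered gauge vector. -/
def gaugeArr (D : ι → ι → ι → ℝ) (μ α β : ι) : ℝ := D β μ α - (1 / 2) * D μ α β

/-- Lowered gauge vector. -/
def gaugeLow (G : Matrix ι ι ℝ) (D : ι → ι → ι → ℝ) (μ : ι) : ℝ :=
  contr₁ G (gaugeArr D μ)

/-- Raised gauge vector. -/
def gaugeUp (G : Matrix ι ι ℝ) (D : ι → ι → ι → ℝ) (ρ : ι) : ℝ :=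
  ∑ σ, G ρ σ * gaugeLow G D σ

/-- Quadratic part of `2 Ric + g^{αβ} ∂²_{αβ} g - 2 g_{α(μ} ∂_{ν)} H^α`. -/
def ricQuad (D : ι → ι → ι → ℝ) (μ ν α β σ ρ : ι) : ℝ :=
  2 * (chr D ν σ α * chr D μ ρ β - chr D α σ β * chr D μ ρ ν) +
    (D ν μ α * gaugeArr D β σ ρ + D ν β σ * gaugeArr D μ α ρ) +
    (D μ ν α * gaugeArr D β σ ρ + D μ β σ * gaugeArr D ν α ρ)

/-- Integrand of `L_{μν}`. -/
def linArr (A B : ι → ι → ι → ℝ) (μ ν α β σ ρ : ι) : ℝ :=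
  2 * (chr A ρ β μ * B σ ν α + chr A ρ β ν * B σ μ α) +
    (1 / 2) * ((2 * A ρ β μ - A μ β ρ) * B ν α σ + (2 * A ρ β ν - A ν β ρ) * B μ α σ)

/-- Integrand of `Q_{μν} + P_{μν}`. -/
def quadArr (B : ι → ι → ι → ℝ) (μ ν α β σ ρ : ι) : ℝ :=
  B σ ν α * B ρ μ β +
    ((1 / 2) * ((B β σ ρ * B μ ν α - B μ σ ρ * B β ν α) +
        (B β σ ρ * B ν μ α - B ν σ ρ * B β μ α)) +
      ((B μ β ρ * B σ ν α - B σ β ρ * B μ ν α) + (B ν β ρ * B σ μ α - B σ β ρ * B ν μ α)) -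
      (B α ν σ * B ρ μ β - B ρ ν σ * B α μ β)) +
    ((1 / 4) * (B μ α β * B ν σ ρ) - (1 / 2) * (B μ α σ * B ν β ρ))

/-- Integrand of the terms proportional to the gauge vector of `B`. -/
def gaugeRem (A B : ι → ι → ι → ℝ) (μ ν α β σ ρ : ι) : ℝ :=
  gaugeArr B ρ α β * (A σ μ ν + B σ μ ν + B μ σ ν + B ν σ μ) -
    gaugeArr B μ α β * gaugeArr B ν σ ρ

theorem contr₂_ricQuad_add (hG : ∀ a b, G a b = G b a) {A B : ι → ι → ι → ℝ}
    (hA : ∀ a b c, A a b c = A a c b) (hB : ∀ a b c, B a b c = B a c b) (μ ν : ι) :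
    contr₂ G (fun α β σ ρ => ricQuad (fun a b c => A a b c + B a b c) μ ν α β σ ρ -
      ricQuad A μ ν α β σ ρ - gaugeArr A ρ α β * B σ μ ν - linArr A B μ ν α β σ ρ -
      quadArr B μ ν α β σ ρ - gaugeRem A B μ ν α β σ ρ) = 0 := by
  refine contr₂_eq_zero hG fun α β σ ρ => ?_
  simp only [ricQuad, linArr, quadArr, gaugeRem, gaugeArr, chr]
  simp only [hA, hB]
  ring

end Algebra

section PartialDerivatives

variable {d : ℕ}

theorem pd_congr {f g : Vec d → ℝ} {V : Set (Vec d)} (hV : IsOpen V) (h : ∀ x ∈ V, f x = g x)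
    {x : Vec d} (hx : x ∈ V) (γ : Fin (d + 1)) : pd γ f x = pd γ g x := by
  have : f =ᶠ[𝓝 x] g := Filter.eventually_of_mem (hV.mem_nhds hx) h
  unfold pd
  rw [this.fderiv_eq]

theorem pd_add {f g : Vec d → ℝ} {x : Vec d} (hf : DifferentiableAt ℝ f x)
    (hg : DifferentiableAt ℝ g x) (γ : Fin (d + 1)) :
    pd γ (fun y => f y + g y) x = pd γ f x + pd γ g x := by
  unfold pd
  rw [fderiv_fun_add hf hg]; rfl

theorem pd_sub {f g : Vec d → ℝ} {x : Vec d} (hf : DifferentiableAt ℝ f x)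
    (hg : DifferentiableAt ℝ g x) (γ : Fin (d + 1)) :
    pd γ (fun y => f y - g y) x = pd γ f x - pd γ g x := by
  unfold pd
  rw [fderiv_fun_sub hf hg]; rfl

theorem pd_mul {f g : Vec d → ℝ} {x : Vec d} (hf : DifferentiableAt ℝ f x)
    (hg : DifferentiableAt ℝ g x) (γ : Fin (d + 1)) :
    pd γ (fun y => f y * g y) x = pd γ f x * g x + f x * pd γ g x := by
  unfold pd
  rw [fderiv_fun_mul hf hg]
  simp only [add_apply, smul_apply, smul_eq_mul]
  ring

theorem pd_const_mul {f : Vec d → ℝ} {x : Vec d} (hf : DifferentiableAt ℝ f x) (c : ℝ)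
    (γ : Fin (d + 1)) : pd γ (fun y => c * f y) x = c * pd γ f x := by
  unfold pd
  rw [fderiv_const_mul hf]; rfl

theorem pd_sum {ι : Type*} [Fintype ι] {f : ι → Vec d → ℝ} {x : Vec d}
    (hf : ∀ i, DifferentiableAt ℝ (f i) x) (γ : Fin (d + 1)) :
    pd γ (fun y => ∑ i, f i y) x = ∑ i, pd γ (f i) x := by
  unfold pd
  rw [fderiv_fun_sum fun i _ => hf i]
  simp

theorem contDiffOn_pd {f : Vec d → ℝ} {V : Set (Vec d)} (hV : IsOpen V)
    (hf : ContDiffOn ℝ (⊤ : ℕ∞) f V) (γ : Fin (d + 1)) :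
    ContDiffOn ℝ (⊤ : ℕ∞) (pd γ f) V :=
  (hf.fderiv_of_isOpen hV (m := (⊤ : ℕ∞)) le_rfl).clm_apply contDiffOn_const

theorem pd_comm {f : Vec d → ℝ} {V : Set (Vec d)} (hV : IsOpen V)
    (hf : ContDiffOn ℝ (⊤ : ℕ∞) f V) {x : Vec d} (hx : x ∈ V) (γ δ : Fin (d + 1)) :
    pd γ (pd δ f) x = pd δ (pd γ f) x := by
  have hfx : ContDiffAt ℝ (⊤ : ℕ∞) f x := hf.contDiffAt (hV.mem_nhds hx)
  have hs : IsSymmSndFDerivAt ℝ f x := hfx.isSymmSndFDerivAt (by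
    rw [minSmoothness_of_isRCLikeNormedField]
    exact WithTop.coe_le_coe.2 (le_top (a := (2 : ℕ∞))))
  have hd : DifferentiableAt ℝ (fderiv ℝ f) x :=
    ((hf.fderiv_of_isOpen hV (m := (⊤ : ℕ∞)) le_rfl).contDiffAt
      (hV.mem_nhds hx)).differentiableAt (by simp)
  have key : ∀ a b : Fin (d + 1), pd a (pd b f) x =
      fderiv ℝ (fderiv ℝ f) x (Pi.single a 1) (Pi.single b 1) := fun a b => by
    unfold pd
    rw [fderiv_clm_apply hd (differentiableAt_const _)]
    simp
  rw [key, key, hs]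

end PartialDerivatives

section MetricJets

variable {d : ℕ} {g : Met d} {V : Set (Vec d)} {x : Vec d}

/-- First derivatives of the metric entries. -/
def jet₁ (g : SymMat d) (x : Vec d) (γ α β : Fin (d + 1)) : ℝ := pd γ (fun y => g y α β) x

/-- Second derivatives of the metric entries. -/
def jet₂ (g : SymMat d) (x : Vec d) (δ γ α β : Fin (d + 1)) : ℝ :=
  pd δ (pd γ (fun y => g y α β)) x

theorem IsMetricOn.symm_apply (hg : IsMetricOn g V) (hx : x ∈ V) (α β : Fin (d + 1)) :
    g x α β = g x β α := ((hg.2.1 x hx).apply α β).symm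

theorem IsMetricOn.ginv_symm (hg : IsMetricOn g V) (hx : x ∈ V) (α β : Fin (d + 1)) :
    ginv g x α β = ginv g x β α := (((hg.2.1 x hx).inv).apply α β).symm

theorem IsMetricOn.sum_ginv_mul (hg : IsMetricOn g V) (hx : x ∈ V) (α β : Fin (d + 1)) :
    ∑ σ, ginv g x α σ * g x σ β = if α = β then 1 else 0 := by
  have := congrFun (congrFun (Matrix.nonsing_inv_mul (g x) (hg.2.2 x hx)) α) β
  rwa [Matrix.mul_apply, Matrix.one_apply] at this

theorem IsMetricOn.sum_mul_ginv (hg : IsMetricOn g V) (hx : x ∈ V) (α β : Fin (d + 1)) :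
    ∑ σ, g x α σ * ginv g x σ β = if α = β then 1 else 0 := by
  have := congrFun (congrFun (Matrix.mul_nonsing_inv (g x) (hg.2.2 x hx)) α) β
  rwa [Matrix.mul_apply, Matrix.one_apply] at this

theorem IsMetricOn.jet₁_symm (hg : IsMetricOn g V) (hV : IsOpen V) (hx : x ∈ V)
    (γ α β : Fin (d + 1)) : jet₁ g x γ α β = jet₁ g x γ β α :=
  pd_congr hV (fun _ hy => hg.symm_apply hy α β) hx γ

theorem IsMetricOn.jet₂_symm (hg : IsMetricOn g V) (hV : IsOpen V) (hx : x ∈ V)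
    (δ γ α β : Fin (d + 1)) : jet₂ g x δ γ α β = jet₂ g x δ γ β α :=
  pd_congr hV (fun _ hy => hg.jet₁_symm hV hy γ α β) hx δ

theorem IsMetricOn.jet₂_comm (hg : IsMetricOn g V) (hV : IsOpen V) (hx : x ∈ V)
    (δ γ α β : Fin (d + 1)) : jet₂ g x δ γ α β = jet₂ g x γ δ α β :=
  pd_comm hV (hg.1 α β) hx δ γ

theorem IsMetricOn.differentiableAt (hg : IsMetricOn g V) (hV : IsOpen V) (hx : x ∈ V)
    (α β : Fin (d + 1)) : DifferentiableAt ℝ (fun y => g y α β) x :=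
  ((hg.1 α β).contDiffAt (hV.mem_nhds hx)).differentiableAt (by simp)

theorem IsMetricOn.differentiableAt_jet₁ (hg : IsMetricOn g V) (hV : IsOpen V) (hx : x ∈ V)
    (γ α β : Fin (d + 1)) : DifferentiableAt ℝ (fun y => jet₁ g y γ α β) x :=
  ((contDiffOn_pd hV (hg.1 α β) γ).contDiffAt (hV.mem_nhds hx)).differentiableAt (by simp)

theorem differentiableAt_det {n : ℕ} {M : Vec d → Matrix (Fin n) (Fin n) ℝ}
    (hM : ∀ i j, DifferentiableAt ℝ (fun y => M y i j) x) :
    DifferentiableAt ℝ (fun y => (M y).det) x := by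
  simp only [Matrix.det_apply']
  refine DifferentiableAt.fun_sum fun σ _ => DifferentiableAt.const_mul ?_ _
  exact (HasFDerivAt.finsetProd (u := Finset.univ) (g := fun i y => M y (σ i) i) fun i _ =>
    (hM (σ i) i).hasFDerivAt).differentiableAt

theorem IsMetricOn.differentiableAt_ginv (hg : IsMetricOn g V) (hV : IsOpen V) (hx : x ∈ V)
    (α β : Fin (d + 1)) : DifferentiableAt ℝ (fun y => ginv g y α β) x := by
  have hd := differentiableAt_det (hg.differentiableAt hV hx)
  have : ∀ y, ginv g y α β = ((g y).det)⁻¹ * ((g y).updateRow β (Pi.single α 1)).det := fun y => by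
    rw [ginv, Matrix.inv_def, Matrix.smul_apply, Matrix.adjugate_apply, Ring.inverse_eq_inv',
      smul_eq_mul]
  simp only [this]
  refine (hd.inv (hg.2.2 x hx).ne_zero).fun_mul (differentiableAt_det fun i j => ?_)
  by_cases hi : i = β
  · subst hi
    simp
  · simpa [Matrix.updateRow_apply, hi] using hg.differentiableAt hV hx i j

theorem IsMetricOn.pd_ginv (hg : IsMetricOn g V) (hV : IsOpen V) (hx : x ∈ V)
    (γ α β : Fin (d + 1)) :
    pd γ (fun y => ginv g y α β) x =
      -∑ σ, ∑ ρ, ginv g x α σ * jet₁ g x γ σ ρ * ginv g x ρ β := by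
  have h1 : ∀ ρ, ∑ σ, (pd γ (fun y => ginv g y α σ) x * g x σ ρ +
      ginv g x α σ * jet₁ g x γ σ ρ) = 0 := fun ρ => by
    have h := pd_congr hV (fun y hy => hg.sum_ginv_mul hy α ρ) hx γ
    rw [pd_sum fun σ =>
      (hg.differentiableAt_ginv hV hx α σ).fun_mul (hg.differentiableAt hV hx σ ρ)] at h
    simp only [pd_mul (hg.differentiableAt_ginv hV hx _ _) (hg.differentiableAt hV hx _ _)] at h
    simp only [jet₁]
    rw [h]
    simp [pd]
  have h2 : ∑ ρ, (∑ σ, (pd γ (fun y => ginv g y α σ) x * g x σ ρ +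
      ginv g x α σ * jet₁ g x γ σ ρ)) * ginv g x ρ β = 0 := by simp [h1]
  simp only [Finset.sum_add_distrib, add_mul, Finset.sum_mul] at h2
  rw [Finset.sum_comm, Finset.sum_comm (f := fun ρ σ => ginv g x α σ * jet₁ g x γ σ ρ * _)] at h2
  simp only [mul_assoc, ← Finset.mul_sum, hg.sum_mul_ginv hx] at h2
  simp only [mul_assoc, ← Finset.mul_sum]
  simp at h2
  linarith

theorem Hgauge_eq (ρ : Fin (d + 1)) :
    Hgauge g g ρ x = gaugeUp (ginv g x) (jet₁ g x) ρ := by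
  simp only [Hgauge, gaugeUp, gaugeLow, contr₁, gaugeArr, jet₁, Finset.mul_sum, mul_assoc]

/-- Derivative of the lowered gauge vector. -/
def gaugeLowDeriv (G : Matrix (Fin (d + 1)) (Fin (d + 1)) ℝ)
    (D : Fin (d + 1) → Fin (d + 1) → Fin (d + 1) → ℝ)
    (S : Fin (d + 1) → Fin (d + 1) → Fin (d + 1) → Fin (d + 1) → ℝ) (ν μ : Fin (d + 1)) : ℝ :=
  contr₁ G (fun α β => S ν β μ α - (1 / 2) * S ν μ α β) -
    contr₂ G fun α β σ ρ => D ν β σ * gaugeArr D μ α ρ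

theorem IsMetricOn.pd_gaugeLow (hg : IsMetricOn g V) (hV : IsOpen V) (hx : x ∈ V)
    (ν μ : Fin (d + 1)) :
    pd ν (fun y => gaugeLow (ginv g y) (jet₁ g y) μ) x =
      gaugeLowDeriv (ginv g x) (jet₁ g x) (jet₂ g x) ν μ := by
  have hD := fun a b c => hg.differentiableAt_jet₁ hV hx a b c
  have hG := fun a b => hg.differentiableAt_ginv hV hx a b
  have hX : ∀ α β, DifferentiableAt ℝ (fun y => gaugeArr (jet₁ g y) μ α β) x := fun α β =>
    (hD β μ α).fun_sub ((hD μ α β).const_mul _)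
  have hpX : ∀ α β, pd ν (fun y => gaugeArr (jet₁ g y) μ α β) x =
      jet₂ g x ν β μ α - (1 / 2) * jet₂ g x ν μ α β := fun α β => by
    simp only [gaugeArr]
    rw [pd_sub (hD β μ α) ((hD μ α β).const_mul _), pd_const_mul (hD μ α β)]
    rfl
  simp only [gaugeLow, contr₁]
  rw [pd_sum fun α => DifferentiableAt.fun_sum fun β _ => (hG α β).fun_mul (hX α β)]
  have : ∀ α, pd ν (fun y => ∑ β, ginv g y α β * gaugeArr (jet₁ g y) μ α β) x =
      ∑ β, (pd ν (fun y => ginv g y α β) x * gaugeArr (jet₁ g x) μ α β +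
        ginv g x α β * (jet₂ g x ν β μ α - (1 / 2) * jet₂ g x ν μ α β)) := fun α => by
    rw [pd_sum fun β => (hG α β).fun_mul (hX α β)]
    simp only [pd_mul (hG _ _) (hX _ _), hpX]
  simp only [this, hg.pd_ginv hV hx, Finset.sum_add_distrib, gaugeLowDeriv, contr₁, contr₂]
  have h3 : ∀ α, ∑ β, -(∑ σ, ∑ ρ, ginv g x α σ * jet₁ g x ν σ ρ * ginv g x ρ β) *
      gaugeArr (jet₁ g x) μ α β = -∑ β, ∑ σ, ∑ ρ, ginv g x α β * ginv g x σ ρ *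
        (jet₁ g x ν β σ * gaugeArr (jet₁ g x) μ α ρ) := fun α => by
    simp only [neg_mul, Finset.sum_neg_distrib, Finset.sum_mul]
    congr 1
    rw [Finset.sum_comm]
    refine Finset.sum_congr rfl fun σ _ => ?_
    rw [Finset.sum_comm]
    refine Finset.sum_congr rfl fun ρ _ => Finset.sum_congr rfl fun β _ => ?_
    ring
  simp only [h3, Finset.sum_neg_distrib]
  ring

theorem IsMetricOn.differentiableAt_gaugeLow (hg : IsMetricOn g V) (hV : IsOpen V) (hx : x ∈ V)
    (μ : Fin (d + 1)) :
    DifferentiableAt ℝ (fun y => gaugeLow (ginv g y) (jet₁ g y) μ) x := by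
  have hD := fun a b c => hg.differentiableAt_jet₁ hV hx a b c
  simp only [gaugeLow, contr₁, gaugeArr]
  exact DifferentiableAt.fun_sum fun α _ => DifferentiableAt.fun_sum fun β _ =>
    (hg.differentiableAt_ginv hV hx α β).fun_mul ((hD β μ α).fun_sub ((hD μ α β).const_mul _))

theorem IsMetricOn.differentiableAt_Hgauge (hg : IsMetricOn g V) (hV : IsOpen V) (hx : x ∈ V)
    (ρ : Fin (d + 1)) : DifferentiableAt ℝ (Hgauge g g ρ) x := by
  rw [show Hgauge g g ρ = fun y => gaugeUp (ginv g y) (jet₁ g y) ρ from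
    funext fun y => Hgauge_eq ρ]
  exact DifferentiableAt.fun_sum fun σ _ =>
    (hg.differentiableAt_ginv hV hx ρ σ).fun_mul (hg.differentiableAt_gaugeLow hV hx σ)

theorem IsMetricOn.sum_mul_pd_Hgauge (hg : IsMetricOn g V) (hV : IsOpen V) (hx : x ∈ V)
    (ν μ : Fin (d + 1)) :
    ∑ α, g x α μ * pd ν (Hgauge g g α) x =
      gaugeLowDeriv (ginv g x) (jet₁ g x) (jet₂ g x) ν μ -
        contr₂ (ginv g x) fun α β σ ρ => jet₁ g x ν μ α * gaugeArr (jet₁ g x) β σ ρ := by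
  have h := pd_congr hV (f := fun y => ∑ α, g y α μ * Hgauge g g α y)
    (g := fun y => gaugeLow (ginv g y) (jet₁ g y) μ) (fun y hy => ?_) hx ν
  · rw [hg.pd_gaugeLow hV hx, pd_sum fun α =>
      (hg.differentiableAt hV hx α μ).fun_mul (hg.differentiableAt_Hgauge hV hx α)] at h
    simp only [pd_mul (hg.differentiableAt hV hx _ _) (hg.differentiableAt_Hgauge hV hx _),
      Finset.sum_add_distrib] at h
    have h2 : ∑ α, pd ν (fun y => g y α μ) x * Hgauge g g α x =
        contr₂ (ginv g x) fun α β σ ρ => jet₁ g x ν μ α * gaugeArr (jet₁ g x) β σ ρ := by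
      simp only [contr₂, Hgauge_eq, gaugeUp, gaugeLow, contr₁, Finset.mul_sum]
      refine Finset.sum_congr rfl fun α _ => Finset.sum_congr rfl fun β _ =>
        Finset.sum_congr rfl fun σ _ => Finset.sum_congr rfl fun ρ _ => ?_
      rw [hg.jet₁_symm hV hx ν μ α]
      simp only [jet₁]
      ring
    linarith
  · simp only [Hgauge_eq, gaugeUp, Finset.mul_sum]
    rw [Finset.sum_comm]
    simp only [← mul_assoc, ← Finset.sum_mul]
    simp only [hg.symm_apply hy _ μ, hg.sum_mul_ginv hy]
    simp

/-- The Ricci tensor in terms of the reduced wave operator and the gauge vector. -/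
theorem IsMetricOn.two_mul_RicciC (hg : IsMetricOn g V) (hV : IsOpen V) (hx : x ∈ V)
    (μ ν : Fin (d + 1)) :
    2 * RicciC g μ ν x =
      -(∑ α, ∑ β, ginv g x α β * jet₂ g x α β μ ν) +
        ∑ α, (g x α μ * pd ν (Hgauge g g α) x + g x α ν * pd μ (Hgauge g g α) x) +
        contr₂ (ginv g x) (ricQuad (jet₁ g x) μ ν) := by
  have hD := fun a b c => hg.differentiableAt_jet₁ hV hx a b c
  have hpC : ∀ δ α β ρ, pd δ (Christoffel g α β ρ) x =
      (1 / 2) * (jet₂ g x δ α ρ β + jet₂ g x δ ρ α β - jet₂ g x δ β α ρ) := fun δ α β ρ => by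
    change pd δ (fun y => (1 / 2) * (jet₁ g y α ρ β + jet₁ g y ρ α β - jet₁ g y β α ρ)) x = _
    rw [pd_const_mul (((hD _ _ _).fun_add (hD _ _ _)).fun_sub (hD _ _ _)),
      pd_sub ((hD _ _ _).fun_add (hD _ _ _)) (hD _ _ _), pd_add (hD _ _ _) (hD _ _ _)]
    rfl
  have hq : (∑ α, ∑ β, ∑ σ, ∑ ρ, ginv g x α β * ginv g x σ ρ *
      (Christoffel g ν σ α x * Christoffel g μ ρ β x -
        Christoffel g α σ β x * Christoffel g μ ρ ν x)) =
      contr₂ (ginv g x) fun α β σ ρ => chr (jet₁ g x) ν σ α * chr (jet₁ g x) μ ρ β -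
        chr (jet₁ g x) α σ β * chr (jet₁ g x) μ ρ ν := rfl
  have hs := hg.jet₂_symm hV hx
  have hc := hg.jet₂_comm hV hx
  have hS : contr₁ (ginv g x) (fun α β =>
      2 * ((1 / 2) * (jet₂ g x β μ ν α + jet₂ g x β ν μ α - jet₂ g x β α μ ν) -
        (1 / 2) * (jet₂ g x ν μ β α + jet₂ g x ν β μ α - jet₂ g x ν α μ β)) +
      jet₂ g x α β μ ν - (jet₂ g x ν β μ α - (1 / 2) * jet₂ g x ν μ α β) -
      (jet₂ g x μ β ν α - (1 / 2) * jet₂ g x μ ν α β)) = 0 := by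
    refine contr₁_eq_zero (hg.ginv_symm hx) fun α β => ?_
    simp only [hs, hc]
    ring
  have hR : contr₂ (ginv g x) (ricQuad (jet₁ g x) μ ν) =
      contr₂ (ginv g x) (fun α β σ ρ => ricQuad (jet₁ g x) μ ν α β σ ρ) := rfl
  rw [RicciC, hq, Finset.sum_add_distrib, hg.sum_mul_pd_Hgauge hV hx, hg.sum_mul_pd_Hgauge hV hx,
    hR]
  change 2 * (contr₁ (ginv g x) _ + _) = -contr₁ (ginv g x) (fun α β => jet₂ g x α β μ ν) + _ + _
  simp only [hpC, ricQuad, contr₂_add, contr₂_const_mul, gaugeLowDeriv]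
  simp only [contr₁_add, contr₁_sub, contr₁_const_mul] at hS ⊢
  linarith

end MetricJets

section DifferenceIdentity

variable {d : ℕ} {g g0 gl : Met d} {V : Set (Vec d)} {x : Vec d}

theorem sum_gaugeUp_mul {ι : Type*} [Fintype ι] (G : Matrix ι ι ℝ) (B : ι → ι → ι → ℝ)
    (Y : ι → ℝ) :
    ∑ σ, gaugeUp G B σ * Y σ = contr₂ G fun α β σ ρ => gaugeArr B ρ α β * Y σ := by
  rw [← contr₂_swap_pairs]
  simp only [gaugeUp, gaugeLow, contr₁, contr₂, Finset.sum_mul, Finset.mul_sum]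
  refine Finset.sum_congr rfl fun σ _ => Finset.sum_congr rfl fun ρ _ =>
    Finset.sum_congr rfl fun α _ => Finset.sum_congr rfl fun β _ => by ring

theorem gaugeLow_mul_gaugeLow {ι : Type*} [Fintype ι] (G : Matrix ι ι ℝ) (B : ι → ι → ι → ℝ)
    (μ ν : ι) : gaugeLow G B μ * gaugeLow G B ν =
      contr₂ G fun α β σ ρ => gaugeArr B μ α β * gaugeArr B ν σ ρ := by
  rw [mul_comm]
  simp only [gaugeLow, contr₁, contr₂, Finset.sum_mul, Finset.mul_sum]
  refine Finset.sum_congr rfl fun σ _ => Finset.sum_congr rfl fun ρ _ =>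
    Finset.sum_congr rfl fun α _ => Finset.sum_congr rfl fun β _ => by ring

theorem contr₂_gaugeRem {ι : Type*} [Fintype ι] (G : Matrix ι ι ℝ) (A B : ι → ι → ι → ℝ)
    (μ ν : ι) :
    contr₂ G (fun α β σ ρ => gaugeRem A B μ ν α β σ ρ) =
      ∑ σ, gaugeUp G B σ * (A σ μ ν + B σ μ ν + B μ σ ν + B ν σ μ) -
        gaugeLow G B μ * gaugeLow G B ν := by
  rw [sum_gaugeUp_mul, gaugeLow_mul_gaugeLow, ← contr₂_sub]
  rfl

theorem Lq_eq (h : SymMat d) (μ ν : Fin (d + 1)) :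
    Lq g h μ ν x = contr₂ (ginv g x) fun α β σ ρ => linArr (jet₁ g x) (jet₁ h x) μ ν α β σ ρ := by
  have h1 : ∑ σ, ∑ ρ, ∑ α, ginv g x σ ρ *
        (GammaMix g ρ α μ x * pd σ (fun y => h y ν α) x +
         GammaMix g ρ α ν x * pd σ (fun y => h y μ α) x) =
      contr₂ (ginv g x) fun α β σ ρ => chr (jet₁ g x) ρ β μ * jet₁ h x σ ν α +
        chr (jet₁ g x) ρ β ν * jet₁ h x σ μ α := by
    rw [← contr₂_swap_pairs]
    refine Finset.sum_congr rfl fun σ _ => Finset.sum_congr rfl fun ρ _ =>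
      Finset.sum_congr rfl fun α _ => ?_
    simp only [GammaMix, Finset.sum_mul, ← Finset.sum_add_distrib, Finset.mul_sum]
    refine Finset.sum_congr rfl fun β _ => ?_
    change _ * (_ * chr (jet₁ g x) ρ β μ * jet₁ h x σ ν α +
      _ * chr (jet₁ g x) ρ β ν * jet₁ h x σ μ α) = _
    ring
  have h2 : ∑ α, ∑ σ, (Dcoef g μ α σ x * pd ν (fun y => h y α σ) x +
        Dcoef g ν α σ x * pd μ (fun y => h y α σ) x) =
      contr₂ (ginv g x) fun α β σ ρ =>
        (2 * jet₁ g x ρ β μ - jet₁ g x μ β ρ) * jet₁ h x ν α σ +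
        (2 * jet₁ g x ρ β ν - jet₁ g x ν β ρ) * jet₁ h x μ α σ := by
    refine Finset.sum_congr rfl fun α _ => ?_
    rw [Finset.sum_comm (s := (Finset.univ : Finset (Fin (d + 1))))
      (t := (Finset.univ : Finset (Fin (d + 1)))) (f := fun β σ => ∑ ρ, _)]
    refine Finset.sum_congr rfl fun σ _ => ?_
    simp only [Dcoef, Finset.sum_mul, ← Finset.sum_add_distrib]
    refine Finset.sum_congr rfl fun β _ => Finset.sum_congr rfl fun ρ _ => ?_
    simp only [jet₁]
    ring
  simp only [Lq, h1, h2, linArr]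
  symm
  refine (contr₂_add _ _).trans ?_
  rw [contr₂_const_mul, contr₂_const_mul]

theorem Qq_add_Pq_eq (h : SymMat d) (μ ν : Fin (d + 1)) :
    Qq g h μ ν x + Pq g h μ ν x =
      contr₂ (ginv g x) fun α β σ ρ => quadArr (jet₁ h x) μ ν α β σ ρ := by
  have h1 : ∑ α, ∑ β, ginv g x α β * Q0R g (fun y => h y ν α) (fun y => h y μ β) x =
      contr₂ (ginv g x) fun α β σ ρ => jet₁ h x σ ν α * jet₁ h x ρ μ β := by
    refine Finset.sum_congr rfl fun α _ => Finset.sum_congr rfl fun β _ => ?_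
    simp only [Q0R, Finset.mul_sum]
    refine Finset.sum_congr rfl fun σ _ => Finset.sum_congr rfl fun ρ _ => ?_
    simp only [jet₁]
    ring
  have h2 : (∑ α, ∑ α', ginv g x α α' * pd μ (fun y => h y α α') x) *
      (∑ β, ∑ β', ginv g x β β' * pd ν (fun y => h y β β') x) =
      contr₂ (ginv g x) fun α β σ ρ => jet₁ h x μ α β * jet₁ h x ν σ ρ := by
    rw [mul_comm]
    simp only [contr₂, Finset.sum_mul, Finset.mul_sum]
    refine Finset.sum_congr rfl fun σ _ => Finset.sum_congr rfl fun ρ _ =>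
      Finset.sum_congr rfl fun α _ => Finset.sum_congr rfl fun β _ => ?_
    simp only [jet₁]
    ring
  have h3 : ∑ α, ∑ α', ∑ β, ∑ β', ginv g x α α' * pd μ (fun y => h y α β) x *
        ginv g x β β' * pd ν (fun y => h y α' β') x =
      contr₂ (ginv g x) fun α β σ ρ => jet₁ h x μ α σ * jet₁ h x ν β ρ := by
    refine Finset.sum_congr rfl fun σ _ => Finset.sum_congr rfl fun ρ _ =>
      Finset.sum_congr rfl fun α _ => Finset.sum_congr rfl fun β _ => ?_
    simp only [jet₁]
    ring
  simp only [quadArr]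
  symm
  refine (contr₂_add _ _).trans ?_
  refine (congrArg₂ (· + ·) (contr₂_add _ _) ((contr₂_sub _ _).trans
    (congrArg₂ (· - ·) (contr₂_const_mul _ _) (contr₂_const_mul _ _)))).trans ?_
  rw [← h1, ← h2, ← h3, Qq, Pq, mul_assoc (1 / 4 : ℝ)]
  rfl

theorem jet₁_sub (h0 : IsMetricOn g0 V) (hl : IsMetricOn gl V) (hV : IsOpen V) (hx : x ∈ V)
    (γ α β : Fin (d + 1)) :
    jet₁ (fun y => gl y - g0 y) x γ α β = jet₁ gl x γ α β - jet₁ g0 x γ α β :=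
  pd_sub (hl.differentiableAt hV hx α β) (h0.differentiableAt hV hx α β) γ

theorem jet₂_sub (h0 : IsMetricOn g0 V) (hl : IsMetricOn gl V) (hV : IsOpen V) (hx : x ∈ V)
    (δ γ α β : Fin (d + 1)) :
    jet₂ (fun y => gl y - g0 y) x δ γ α β = jet₂ gl x δ γ α β - jet₂ g0 x δ γ α β :=
  (pd_congr hV (fun _ hy => jet₁_sub h0 hl hV hy γ α β) hx δ).trans
    (pd_sub (hl.differentiableAt_jet₁ hV hx γ α β) (h0.differentiableAt_jet₁ hV hx γ α β) δ)

theorem ginv_sub_ginv (h0 : IsMetricOn g0 V) (hl : IsMetricOn gl V) (hx : x ∈ V) :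
    ginv gl x - ginv g0 x = -(ginv g0 x * (gl x - g0 x) * ginv gl x) := by
  rw [mul_sub, sub_mul, ginv, ginv, Matrix.nonsing_inv_mul _ (h0.2.2 x hx), one_mul, mul_assoc,
    Matrix.mul_nonsing_inv _ (hl.2.2 x hx), mul_one, neg_sub]

theorem contr₁_sub_left {ι : Type*} [Fintype ι] (G G' : Matrix ι ι ℝ) (T : ι → ι → ℝ) :
    contr₁ (G - G') T = contr₁ G T - contr₁ G' T := by
  simp only [contr₁, Matrix.sub_apply, sub_mul, Finset.sum_sub_distrib]

/-- The wave equation for the difference of a Ricci-flat metric and a background metric, with an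
explicit remainder. -/
theorem wave_difference_eq (h0 : IsMetricOn g0 V) (hl : IsMetricOn gl V) (hV : IsOpen V)
    (hx : x ∈ V) (μ ν : Fin (d + 1)) (hRic : RicciC gl μ ν x = 0) :
    ((∑ α, ∑ β, ginv g0 x α β * pd α (pd β (fun y => gl y μ ν - g0 y μ ν)) x) -
        ∑ α, Hgauge g0 g0 α x * pd α (fun y => gl y μ ν - g0 y μ ν) x) -
      2 * RicciC g0 μ ν x -
      (∑ α, ∑ β, ∑ α', ∑ β', ginv g0 x α α' * ginv g0 x β β' * (gl x α' β' - g0 x α' β') *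
        pd α (pd β (fun y => gl y μ ν - g0 y μ ν)) x) -
      Lq g0 (fun y => gl y - g0 y) μ ν x -
      Qq g0 (fun y => gl y - g0 y) μ ν x -
      Pq g0 (fun y => gl y - g0 y) μ ν x -
      (∑ α, (g0 x α μ * pd ν (fun y => Hgauge gl gl α y - Hgauge g0 g0 α y) x +
             g0 x α ν * pd μ (fun y => Hgauge gl gl α y - Hgauge g0 g0 α y) x)) =
    contr₁ (ginv g0 x * (gl x - g0 x) * ginv g0 x) (fun α β => jet₂ g0 x α β μ ν) -
      contr₁ (ginv g0 x * (gl x - g0 x) * (ginv g0 x * (gl x - g0 x) * ginv gl x))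
        (fun α β => jet₂ gl x α β μ ν) +
      ∑ α, ((gl x - g0 x) α μ * pd ν (Hgauge gl gl α) x +
        (gl x - g0 x) α ν * pd μ (Hgauge gl gl α) x) +
      (contr₂ (ginv gl x) (ricQuad (jet₁ gl x) μ ν) -
        contr₂ (ginv g0 x) (ricQuad (jet₁ gl x) μ ν)) +
      (∑ σ, gaugeUp (ginv g0 x) (jet₁ (fun y => gl y - g0 y) x) σ *
          (jet₁ gl x σ μ ν + jet₁ (fun y => gl y - g0 y) x μ σ ν +
            jet₁ (fun y => gl y - g0 y) x ν σ μ) -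
        gaugeLow (ginv g0 x) (jet₁ (fun y => gl y - g0 y) x) μ *
          gaugeLow (ginv g0 x) (jet₁ (fun y => gl y - g0 y) x) ν) := by
  set B := jet₁ (fun y => gl y - g0 y) x with hBdef
  have hB : ∀ γ α β, B γ α β = jet₁ gl x γ α β - jet₁ g0 x γ α β := jet₁_sub h0 hl hV hx
  have hAl : jet₁ gl x = fun γ α β => jet₁ g0 x γ α β + B γ α β := by
    funext γ α β
    rw [hB]; ring
  have hBsymm : ∀ γ α β, B γ α β = B γ β α := fun γ α β => by
    rw [hB, hB, hl.jet₁_symm hV hx, h0.jet₁_symm hV hx]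
  have hpd1 : ∀ α, pd α (fun y => gl y μ ν - g0 y μ ν) x = B α μ ν := fun α => rfl
  have hpd2 : ∀ α β, pd α (pd β (fun y => gl y μ ν - g0 y μ ν)) x =
      jet₂ gl x α β μ ν - jet₂ g0 x α β μ ν := fun α β => jet₂_sub h0 hl hV hx α β μ ν
  have hpdH : ∀ γ α, pd γ (fun y => Hgauge gl gl α y - Hgauge g0 g0 α y) x =
      pd γ (Hgauge gl gl α) x - pd γ (Hgauge g0 g0 α) x := fun γ α =>
    pd_sub (hl.differentiableAt_Hgauge hV hx α) (h0.differentiableAt_Hgauge hV hx α) γ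
  have hquad := contr₂_ricQuad_add (h0.ginv_symm hx) (h0.jet₁_symm hV hx) hBsymm μ ν
  rw [contr₂_sub, contr₂_sub, contr₂_sub, contr₂_sub, contr₂_sub, ← hAl, contr₂_gaugeRem,
    ← sum_gaugeUp_mul, ← Lq_eq, ← Qq_add_Pq_eq] at hquad
  have hsum : ∀ σ, jet₁ g0 x σ μ ν + B σ μ ν = jet₁ gl x σ μ ν := fun σ => by rw [hB]; ring
  simp only [hsum] at hquad
  have hK : ∑ α, ∑ β, ∑ α', ∑ β', ginv g0 x α α' * ginv g0 x β β' * (gl x α' β' - g0 x α' β') *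
        pd α (pd β (fun y => gl y μ ν - g0 y μ ν)) x =
      contr₁ (ginv g0 x * (gl x - g0 x) * ginv g0 x) (fun α β => jet₂ gl x α β μ ν) -
      contr₁ (ginv g0 x * (gl x - g0 x) * ginv g0 x) (fun α β => jet₂ g0 x α β μ ν) := by
    rw [← contr₁_sub]
    refine Finset.sum_congr rfl fun α _ => Finset.sum_congr rfl fun β _ => ?_
    simp only [hpd2, Matrix.mul_apply, Finset.sum_mul, Matrix.sub_apply]
    rw [Finset.sum_comm]
    refine Finset.sum_congr rfl fun α' _ => Finset.sum_congr rfl fun β' _ => ?_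
    rw [h0.ginv_symm hx β]
    ring
  have hM : contr₁ (ginv g0 x * (gl x - g0 x) * (ginv g0 x * (gl x - g0 x) * ginv gl x))
        (fun α β => jet₂ gl x α β μ ν) =
      contr₁ (ginv g0 x * (gl x - g0 x) * ginv g0 x) (fun α β => jet₂ gl x α β μ ν) -
        (contr₁ (ginv g0 x) (fun α β => jet₂ gl x α β μ ν) -
          contr₁ (ginv gl x) (fun α β => jet₂ gl x α β μ ν)) := by
    rw [← contr₁_sub_left, ← contr₁_sub_left]
    congr 1
    have h := ginv_sub_ginv h0 hl hx
    have e1 : ginv g0 x * (gl x - g0 x) * ginv gl x = ginv g0 x - ginv gl x := by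
      rw [← neg_sub (ginv gl x), h, neg_neg]
    rw [e1, mul_sub, e1]
  have hR0 := h0.two_mul_RicciC hV hx μ ν
  have hRl := hl.two_mul_RicciC hV hx μ ν
  rw [hRic, mul_zero] at hRl
  have hbox : ∑ α, ∑ β, ginv g0 x α β * pd α (pd β (fun y => gl y μ ν - g0 y μ ν)) x =
      contr₁ (ginv g0 x) (fun α β => jet₂ gl x α β μ ν) -
        contr₁ (ginv g0 x) (fun α β => jet₂ g0 x α β μ ν) := by
    rw [← contr₁_sub]
    simp only [hpd2, contr₁]
  have hH : ∑ α, (g0 x α μ * pd ν (fun y => Hgauge gl gl α y - Hgauge g0 g0 α y) x +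
        g0 x α ν * pd μ (fun y => Hgauge gl gl α y - Hgauge g0 g0 α y) x) =
      ∑ α, (gl x α μ * pd ν (Hgauge gl gl α) x + gl x α ν * pd μ (Hgauge gl gl α) x) -
      ∑ α, (g0 x α μ * pd ν (Hgauge g0 g0 α) x + g0 x α ν * pd μ (Hgauge g0 g0 α) x) -
      ∑ α, ((gl x - g0 x) α μ * pd ν (Hgauge gl gl α) x +
        (gl x - g0 x) α ν * pd μ (Hgauge gl gl α) x) := by
    rw [← Finset.sum_sub_distrib, ← Finset.sum_sub_distrib]
    refine Finset.sum_congr rfl fun α _ => ?_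
    rw [hpdH, hpdH, Matrix.sub_apply, Matrix.sub_apply]
    ring
  have e1 : ∑ α, ∑ β, ginv g0 x α β * jet₂ g0 x α β μ ν =
    contr₁ (ginv g0 x) (fun α β => jet₂ g0 x α β μ ν) := rfl
  have e2 : ∑ α, ∑ β, ginv gl x α β * jet₂ gl x α β μ ν =
    contr₁ (ginv gl x) (fun α β => jet₂ gl x α β μ ν) := rfl
  rw [e1] at hR0
  rw [e2] at hRl
  rw [hK, hM, hbox, hH]
  simp only [hpd1, Hgauge_eq] at hR0 hRl ⊢
  linarith

end DifferenceIdentity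

section Asymptotics

open Asymptotics

variable {P ι : Type*} {l : Filter P} {e f : P → ℝ} {D : P → ι → ι → ι → ℝ}

theorem isBigO_gaugeArr (hD : ∀ a b c, (fun p => D p a b c) =O[l] e) (μ α β : ι) :
    (fun p => gaugeArr (D p) μ α β) =O[l] e :=
  (hD β μ α).sub ((hD μ α β).const_mul_left _)

theorem isBigO_chr (hD : ∀ a b c, (fun p => D p a b c) =O[l] e) (α β μ : ι) :
    (fun p => chr (D p) α β μ) =O[l] e :=
  (((hD α μ β).add (hD μ α β)).sub (hD β α μ)).const_mul_left _

theorem isBigO_ricQuad (hD : ∀ a b c, (fun p => D p a b c) =O[l] fun _ => (1 : ℝ))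
    (μ ν α β σ ρ : ι) : (fun p => ricQuad (D p) μ ν α β σ ρ) =O[l] fun _ => (1 : ℝ) := by
  have hc := isBigO_chr hD
  have hg := isBigO_gaugeArr hD
  have hm : ∀ {a b : P → ℝ}, a =O[l] (fun _ => (1 : ℝ)) → b =O[l] (fun _ => (1 : ℝ)) →
      (fun p => a p * b p) =O[l] fun _ => (1 : ℝ) := fun ha hb => by
    simpa only [mul_one] using ha.mul hb
  exact (((((hm (hc _ _ _) (hc _ _ _)).sub (hm (hc _ _ _) (hc _ _ _))).const_mul_left _).add
    ((hm (hD _ _ _) (hg _ _ _)).add (hm (hD _ _ _) (hg _ _ _)))).add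
    ((hm (hD _ _ _) (hg _ _ _)).add (hm (hD _ _ _) (hg _ _ _))))

variable [Fintype ι] {G G' : P → Matrix ι ι ℝ}

theorem isBigO_matrix_mul (hG : ∀ i j, (fun p => G p i j) =O[l] e)
    (hG' : ∀ i j, (fun p => G' p i j) =O[l] f) (i j : ι) :
    (fun p => (G p * G' p) i j) =O[l] fun p => e p * f p := by
  simp only [Matrix.mul_apply]
  exact IsBigO.fun_sum fun k _ => (hG i k).mul (hG' k j)

theorem isBigO_contr₁ {T : P → ι → ι → ℝ} (hG : ∀ i j, (fun p => G p i j) =O[l] e)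
    (hT : ∀ i j, (fun p => T p i j) =O[l] f) :
    (fun p => contr₁ (G p) (T p)) =O[l] fun p => e p * f p :=
  IsBigO.fun_sum fun i _ => IsBigO.fun_sum fun j _ => (hG i j).mul (hT i j)

theorem isBigO_mul_sub_mul {a b a' b' : P → ℝ} (ha' : a' =O[l] fun _ => (1 : ℝ))
    (hb : b =O[l] fun _ => (1 : ℝ)) (haa : (fun p => a p - a' p) =O[l] e)
    (hbb : (fun p => b p - b' p) =O[l] e) :
    (fun p => a p * b p - a' p * b' p) =O[l] e := by
  have h1 := haa.mul hb
  have h2 := ha'.mul hbb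
  simp only [mul_one, one_mul] at h1 h2
  exact (h1.add h2).congr_left fun p => by ring

theorem isBigO_contr₂_sub {Φ : P → ι → ι → ι → ι → ℝ}
    (hG : ∀ i j, (fun p => G p i j) =O[l] fun _ => (1 : ℝ))
    (hG' : ∀ i j, (fun p => G' p i j) =O[l] fun _ => (1 : ℝ))
    (hGG : ∀ i j, (fun p => G p i j - G' p i j) =O[l] e)
    (hΦ : ∀ α β σ ρ, (fun p => Φ p α β σ ρ) =O[l] fun _ => (1 : ℝ)) :
    (fun p => contr₂ (G p) (Φ p) - contr₂ (G' p) (Φ p)) =O[l] e := by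
  simp only [contr₂, ← Finset.sum_sub_distrib, ← sub_mul]
  refine IsBigO.fun_sum fun α _ => IsBigO.fun_sum fun β _ => IsBigO.fun_sum fun σ _ =>
    IsBigO.fun_sum fun ρ _ => ?_
  simpa only [mul_one] using
    (isBigO_mul_sub_mul (hG' α β) (hG σ ρ) (hGG α β) (hGG σ ρ)).mul (hΦ α β σ ρ)

theorem isBigO_gaugeUp_sub (hG : ∀ i j, (fun p => G p i j) =O[l] fun _ => (1 : ℝ))
    (hG' : ∀ i j, (fun p => G' p i j) =O[l] fun _ => (1 : ℝ))
    (hGG : ∀ i j, (fun p => G p i j - G' p i j) =O[l] e)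
    (hD : ∀ a b c, (fun p => D p a b c) =O[l] fun _ => (1 : ℝ)) (ρ : ι) :
    (fun p => gaugeUp (G p) (D p) ρ - gaugeUp (G' p) (D p) ρ) =O[l] e := by
  have hg := isBigO_gaugeArr hD
  simp only [gaugeUp, ← Finset.sum_sub_distrib]
  refine IsBigO.fun_sum fun σ _ => isBigO_mul_sub_mul (hG' ρ σ) ?_ (hGG ρ σ) ?_
  · exact (isBigO_contr₁ hG (hg σ)).congr_right fun _ => mul_one _
  · simp only [gaugeLow, ← contr₁_sub_left]
    simpa only [mul_one] using isBigO_contr₁ (G := fun p => G p - G' p) hGG (hg σ)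

theorem gaugeUp_sub (M : Matrix ι ι ℝ) (A B : ι → ι → ι → ℝ) (ρ : ι) :
    gaugeUp M (fun a b c => A a b c - B a b c) ρ = gaugeUp M A ρ - gaugeUp M B ρ := by
  simp only [gaugeUp, gaugeLow, ← Finset.sum_sub_distrib, ← mul_sub, ← contr₁_sub]
  refine Finset.sum_congr rfl fun σ _ => ?_
  congr 2
  funext α β
  simp only [gaugeArr]
  ring

/-- A Ricci-flat metric `gl` oscillating at scale `lam` about a background metric `g0`, with bounds
by the constant `C` at a point `x` of their common domain. -/
structure BoundedMetricPair (d : ℕ) (C : ℝ) where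
  lam : ℝ
  eta : ℝ
  V : Set (Vec d)
  g0 : Met d
  gl : Met d
  x : Vec d
  lam_mem : lam ∈ Set.Ioc (0 : ℝ) 1
  eta_mem : eta ∈ Set.Ioc (0 : ℝ) 1
  isOpen : IsOpen V
  metric0 : IsMetricOn g0 V
  metricl : IsMetricOn gl V
  mem : x ∈ V
  ricci : ∀ μ ν : Fin (d + 1), RicciC gl μ ν x = 0
  bound0 : ∀ α β : Fin (d + 1), |g0 x α β| ≤ C ∧ |ginv g0 x α β| ≤ C
  bound0_jet₁ : ∀ γ α β : Fin (d + 1), |jet₁ g0 x γ α β| ≤ C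
  bound0_jet₂ : ∀ δ γ α β : Fin (d + 1), |jet₂ g0 x δ γ α β| ≤ C
  boundl_ginv : ∀ α β : Fin (d + 1), |ginv gl x α β| ≤ C
  boundl_jet₁ : ∀ γ α β : Fin (d + 1), |jet₁ gl x γ α β| ≤ C
  boundl_jet₂ : ∀ δ γ α β : Fin (d + 1), |jet₂ gl x δ γ α β| ≤ C * lam⁻¹
  bound_sub : ∀ α β : Fin (d + 1), |gl x α β - g0 x α β| ≤ C * lam
  bound_gauge_sub : ∀ α : Fin (d + 1), |Hgauge gl gl α x - Hgauge g0 g0 α x| ≤ C * lam ^ eta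
  bound_pd_gauge : ∀ γ α : Fin (d + 1), |pd γ (Hgauge gl gl α) x| ≤ C

namespace BoundedMetricPair

variable {d : ℕ} {C : ℝ}

theorem isBigO_of_abs_le {a b : BoundedMetricPair d C → ℝ} (h : ∀ p, |a p| ≤ C * b p)
    (hb : ∀ p, 0 ≤ b p) : a =O[⊤] b :=
  isBigO_top.2 ⟨C, fun p => by simpa [abs_of_nonneg (hb p)] using h p⟩

theorem isBigO_one_of_abs_le {a : BoundedMetricPair d C → ℝ} (h : ∀ p, |a p| ≤ C) :
    a =O[⊤] fun _ => (1 : ℝ) :=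
  isBigO_of_abs_le (fun p => by simpa using h p) fun _ => zero_le_one

theorem isBigO_lam : (fun p : BoundedMetricPair d C => p.lam) =O[⊤] fun p => p.lam ^ p.eta := by
  refine isBigO_top.2 ⟨1, fun p => ?_⟩
  have h0 := p.lam_mem.1
  rw [one_mul, Real.norm_of_nonneg h0.le, Real.norm_of_nonneg (Real.rpow_nonneg h0.le _)]
  simpa using Real.rpow_le_rpow_of_exponent_ge h0 p.lam_mem.2 p.eta_mem.2

theorem isBigO_sub (i j : Fin (d + 1)) :
    (fun p : BoundedMetricPair d C => (p.gl p.x - p.g0 p.x) i j) =O[⊤] fun p => p.lam :=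
  isBigO_of_abs_le (fun p => p.bound_sub i j) fun p => p.lam_mem.1.le

theorem isBigO_ginv_sub (α β : Fin (d + 1)) :
    (fun p : BoundedMetricPair d C => ginv p.gl p.x α β - ginv p.g0 p.x α β) =O[⊤]
      fun p => p.lam ^ p.eta := by
  have h := isBigO_matrix_mul (isBigO_matrix_mul (fun i j => isBigO_one_of_abs_le
    fun p : BoundedMetricPair d C => (p.bound0 i j).2) isBigO_sub)
    (fun i j => isBigO_one_of_abs_le fun p => p.boundl_ginv i j) α β
  simp only [one_mul, mul_one] at h
  refine (h.neg_left.congr_left fun p => ?_).trans isBigO_lam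
  exact (congrFun (congrFun (ginv_sub_ginv p.metric0 p.metricl p.mem) α) β).symm

theorem isBigO_jet₁_sub (a b c : Fin (d + 1)) :
    (fun p : BoundedMetricPair d C => jet₁ (fun y => p.gl y - p.g0 y) p.x a b c) =O[⊤]
      fun _ => (1 : ℝ) := by
  simp only [fun p : BoundedMetricPair d C => jet₁_sub p.metric0 p.metricl p.isOpen p.mem a b c]
  exact (isBigO_one_of_abs_le fun p => p.boundl_jet₁ a b c).sub
    (isBigO_one_of_abs_le fun p => p.bound0_jet₁ a b c)

theorem isBigO_gaugeUp (ρ : Fin (d + 1)) :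
    (fun p : BoundedMetricPair d C =>
      gaugeUp (ginv p.g0 p.x) (jet₁ (fun y => p.gl y - p.g0 y) p.x) ρ) =O[⊤]
      fun p => p.lam ^ p.eta := by
  have h1 : (fun p : BoundedMetricPair d C => Hgauge p.gl p.gl ρ p.x - Hgauge p.g0 p.g0 ρ p.x)
      =O[⊤] fun p => p.lam ^ p.eta :=
    isBigO_of_abs_le (fun p => p.bound_gauge_sub ρ) fun p => Real.rpow_nonneg p.lam_mem.1.le _
  have h2 := isBigO_gaugeUp_sub (D := fun p : BoundedMetricPair d C => jet₁ p.gl p.x)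
    (fun i j => isBigO_one_of_abs_le fun p => p.boundl_ginv i j)
    (fun i j => isBigO_one_of_abs_le fun p => (p.bound0 i j).2) isBigO_ginv_sub
    (fun a b c => isBigO_one_of_abs_le fun p => p.boundl_jet₁ a b c) ρ
  refine (h1.sub h2).congr_left fun p => ?_
  have hB : jet₁ (fun y => p.gl y - p.g0 y) p.x =
      fun a b c => jet₁ p.gl p.x a b c - jet₁ p.g0 p.x a b c := by
    funext a b c
    exact jet₁_sub p.metric0 p.metricl p.isOpen p.mem a b c
  rw [hB, gaugeUp_sub, Hgauge_eq, Hgauge_eq]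
  ring

theorem isBigO_gaugeLow (μ : Fin (d + 1)) :
    (fun p : BoundedMetricPair d C =>
      gaugeLow (ginv p.g0 p.x) (jet₁ (fun y => p.gl y - p.g0 y) p.x) μ) =O[⊤]
      fun p => p.lam ^ p.eta := by
  have h : ∀ p : BoundedMetricPair d C,
      gaugeLow (ginv p.g0 p.x) (jet₁ (fun y => p.gl y - p.g0 y) p.x) μ =
        ∑ ρ, p.g0 p.x μ ρ *
          gaugeUp (ginv p.g0 p.x) (jet₁ (fun y => p.gl y - p.g0 y) p.x) ρ := fun p => by
    simp only [gaugeUp, Finset.mul_sum, ← mul_assoc]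
    rw [Finset.sum_comm]
    simp only [← Finset.sum_mul, p.metric0.sum_mul_ginv p.mem, ite_mul, one_mul, zero_mul,
      Finset.sum_ite_eq, Finset.mem_univ, if_true]
  simp only [h]
  refine IsBigO.fun_sum fun ρ _ => ?_
  simpa only [one_mul] using
    (isBigO_one_of_abs_le fun p : BoundedMetricPair d C => (p.bound0 μ ρ).1).mul (isBigO_gaugeUp ρ)

/-- The error in the wave equation for the metric difference. -/
def waveError (p : BoundedMetricPair d C) (μ ν : Fin (d + 1)) : ℝ :=
  ((∑ α, ∑ β, ginv p.g0 p.x α β * pd α (pd β (fun y => p.gl y μ ν - p.g0 y μ ν)) p.x) -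
      ∑ α, Hgauge p.g0 p.g0 α p.x * pd α (fun y => p.gl y μ ν - p.g0 y μ ν) p.x) -
    2 * RicciC p.g0 μ ν p.x -
    (∑ α, ∑ β, ∑ α', ∑ β', ginv p.g0 p.x α α' * ginv p.g0 p.x β β' *
      (p.gl p.x α' β' - p.g0 p.x α' β') *
      pd α (pd β (fun y => p.gl y μ ν - p.g0 y μ ν)) p.x) -
    Lq p.g0 (fun y => p.gl y - p.g0 y) μ ν p.x -
    Qq p.g0 (fun y => p.gl y - p.g0 y) μ ν p.x -
    Pq p.g0 (fun y => p.gl y - p.g0 y) μ ν p.x -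
    (∑ α, (p.g0 p.x α μ * pd ν (fun y => Hgauge p.gl p.gl α y - Hgauge p.g0 p.g0 α y) p.x +
           p.g0 p.x α ν * pd μ (fun y => Hgauge p.gl p.gl α y - Hgauge p.g0 p.g0 α y) p.x))

theorem isBigO_waveError (μ ν : Fin (d + 1)) :
    (fun p : BoundedMetricPair d C => p.waveError μ ν) =O[⊤] fun p => p.lam ^ p.eta := by
  have hG0 : ∀ i j, (fun p : BoundedMetricPair d C => ginv p.g0 p.x i j) =O[⊤]
      fun _ => (1 : ℝ) := fun i j => isBigO_one_of_abs_le fun p => (p.bound0 i j).2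
  have hGl : ∀ i j, (fun p : BoundedMetricPair d C => ginv p.gl p.x i j) =O[⊤]
      fun _ => (1 : ℝ) := fun i j => isBigO_one_of_abs_le fun p => p.boundl_ginv i j
  have hAl : ∀ a b c, (fun p : BoundedMetricPair d C => jet₁ p.gl p.x a b c) =O[⊤]
      fun _ => (1 : ℝ) := fun a b c => isBigO_one_of_abs_le fun p => p.boundl_jet₁ a b c
  have hH : ∀ γ α, (fun p : BoundedMetricPair d C => pd γ (Hgauge p.gl p.gl α) p.x) =O[⊤]
      fun _ => (1 : ℝ) := fun γ α => isBigO_one_of_abs_le fun p => p.bound_pd_gauge γ α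
  have hS0 : ∀ α β, (fun p : BoundedMetricPair d C => jet₂ p.g0 p.x α β μ ν) =O[⊤]
      fun _ => (1 : ℝ) := fun α β => isBigO_one_of_abs_le fun p => p.bound0_jet₂ α β μ ν
  have hSl : ∀ α β, (fun p : BoundedMetricPair d C => jet₂ p.gl p.x α β μ ν) =O[⊤]
      fun p => p.lam⁻¹ := fun α β =>
    isBigO_of_abs_le (fun p => p.boundl_jet₂ α β μ ν) fun p => inv_nonneg.2 p.lam_mem.1.le
  have hGK := isBigO_matrix_mul hG0 isBigO_sub
  have t1 := isBigO_contr₁ (isBigO_matrix_mul hGK hG0) hS0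
  have t2 := isBigO_contr₁ (isBigO_matrix_mul hGK (isBigO_matrix_mul hGK hGl)) hSl
  have hlam : ∀ p : BoundedMetricPair d C, p.lam * p.lam * p.lam⁻¹ = p.lam := fun p =>
    mul_inv_cancel_right₀ p.lam_mem.1.ne' _
  have t3 : (fun p : BoundedMetricPair d C =>
      ∑ α, ((p.gl p.x - p.g0 p.x) α μ * pd ν (Hgauge p.gl p.gl α) p.x +
        (p.gl p.x - p.g0 p.x) α ν * pd μ (Hgauge p.gl p.gl α) p.x)) =O[⊤]
      fun p => p.lam * 1 :=
    IsBigO.fun_sum fun α _ => ((isBigO_sub α μ).mul (hH ν α)).add ((isBigO_sub α ν).mul (hH μ α))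
  have t4 := isBigO_contr₂_sub hGl hG0 isBigO_ginv_sub (isBigO_ricQuad hAl μ ν)
  have hlow : ∀ μ, (fun p : BoundedMetricPair d C =>
      gaugeLow (ginv p.g0 p.x) (jet₁ (fun y => p.gl y - p.g0 y) p.x) μ) =O[⊤]
      fun _ => (1 : ℝ) := fun μ => by
    exact (isBigO_contr₁ hG0 (isBigO_gaugeArr isBigO_jet₁_sub μ)).congr_right fun _ => mul_one _
  have t5 := IsBigO.fun_sum (s := Finset.univ) fun (σ : Fin (d + 1)) _ =>
    (isBigO_gaugeUp (C := C) σ).mul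
      (((hAl σ μ ν).add (isBigO_jet₁_sub μ σ ν)).add (isBigO_jet₁_sub ν σ μ))
  have t6 := (isBigO_gaugeLow μ).mul (hlow ν)
  simp only [one_mul, mul_one, hlam] at t1 t2 t3 t5 t6
  refine (((((t1.sub t2).add t3).trans isBigO_lam).add t4).add (t5.sub t6)).congr_left fun p => ?_
  exact (wave_difference_eq p.metric0 p.metricl p.isOpen p.mem μ ν (p.ricci μ ν)).symm

end BoundedMetricPair

end Asymptotics

/-- Structure of the wave equation for the metric difference. -/
theorem stmt17
    (d : ℕ) (hd : 1 ≤ d) (C1 : ℝ) (hC1 : 1 ≤ C1) :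
    ∃ C2 : ℝ, ∀ lam : ℝ, lam ∈ Set.Ioc (0 : ℝ) 1 → ∀ eta : ℝ, eta ∈ Set.Ioc (0 : ℝ) 1 →
      ∀ V : Set (Vec d), IsOpen V →
      ∀ g0 gl : Met d, IsMetricOn g0 V → IsMetricOn gl V →
      (∀ x ∈ V, ∀ μ ν : Fin (d + 1), RicciC gl μ ν x = 0) →
      (∀ x ∈ V, ∀ α β : Fin (d + 1), |g0 x α β| ≤ C1 ∧ |ginv g0 x α β| ≤ C1) →
      (∀ x ∈ V, ∀ γ α β : Fin (d + 1), |pd γ (fun y => g0 y α β) x| ≤ C1) →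
      (∀ x ∈ V, ∀ γ δ α β : Fin (d + 1), |pd δ (pd γ (fun y => g0 y α β)) x| ≤ C1) →
      (∀ x ∈ V, ∀ α β : Fin (d + 1), |gl x α β| ≤ C1 ∧ |ginv gl x α β| ≤ C1) →
      (∀ x ∈ V, ∀ γ α β : Fin (d + 1), |pd γ (fun y => gl y α β) x| ≤ C1) →
      (∀ x ∈ V, ∀ γ δ α β : Fin (d + 1),
        |pd δ (pd γ (fun y => gl y α β)) x| ≤ C1 * lam⁻¹) →
      (∀ x ∈ V, ∀ α β : Fin (d + 1), |gl x α β - g0 x α β| ≤ C1 * lam) →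
      (∀ x ∈ V, ∀ α : Fin (d + 1), |Hgauge gl gl α x - Hgauge g0 g0 α x| ≤ C1 * lam ^ eta) →
      (∀ x ∈ V, ∀ γ α : Fin (d + 1), |pd γ (Hgauge gl gl α) x| ≤ C1) →
      ∀ x ∈ V, ∀ μ ν : Fin (d + 1),
        |((∑ α, ∑ β, ginv g0 x α β * pd α (pd β (fun y => gl y μ ν - g0 y μ ν)) x) -
            ∑ α, Hgauge g0 g0 α x * pd α (fun y => gl y μ ν - g0 y μ ν) x) -
          2 * RicciC g0 μ ν x -
          (∑ α, ∑ β, ∑ α', ∑ β', ginv g0 x α α' * ginv g0 x β β' * (gl x α' β' - g0 x α' β') *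
            pd α (pd β (fun y => gl y μ ν - g0 y μ ν)) x) -
          Lq g0 (fun y => gl y - g0 y) μ ν x -
          Qq g0 (fun y => gl y - g0 y) μ ν x -
          Pq g0 (fun y => gl y - g0 y) μ ν x -
          (∑ α, (g0 x α μ * pd ν (fun y => Hgauge gl gl α y - Hgauge g0 g0 α y) x +
                 g0 x α ν * pd μ (fun y => Hgauge gl gl α y - Hgauge g0 g0 α y) x))| ≤
          C2 * lam ^ eta := by
  choose c hc using fun μ ν : Fin (d + 1) =>
    Asymptotics.isBigO_top.1 (BoundedMetricPair.isBigO_waveError (C := C1) μ ν)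
  refine ⟨∑ μ, ∑ ν, |c μ ν|, fun lam hlam eta heta V hV g0 gl h0 hl hRic hb0 hb01 hb02 hbl hbl1
    hbl2 hsub hH hpdH x hx μ ν => ?_⟩
  let p : BoundedMetricPair d C1 :=
    { lam, eta, V, g0, gl, x
      lam_mem := hlam
      eta_mem := heta
      isOpen := hV
      metric0 := h0
      metricl := hl
      mem := hx
      ricci := hRic x hx
      bound0 := hb0 x hx
      bound0_jet₁ := hb01 x hx
      bound0_jet₂ := fun δ γ => hb02 x hx γ δ
      boundl_ginv := fun α β => (hbl x hx α β).2
      boundl_jet₁ := hbl1 x hx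
      boundl_jet₂ := fun δ γ => hbl2 x hx γ δ
      bound_sub := hsub x hx
      bound_gauge_sub := hH x hx
      bound_pd_gauge := hpdH x hx }
  have hpow : 0 ≤ lam ^ eta := Real.rpow_nonneg hlam.1.le _
  have h1 : |c μ ν| ≤ ∑ μ, ∑ ν, |c μ ν| :=
    (Finset.single_le_sum (f := fun ν => |c μ ν|) (fun _ _ => abs_nonneg _)
      (Finset.mem_univ ν)).trans
    (Finset.single_le_sum (f := fun μ => ∑ ν, |c μ ν|)
      (fun _ _ => Finset.sum_nonneg fun _ _ => abs_nonneg _) (Finset.mem_univ μ))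
  have h2 : |p.waveError μ ν| ≤ c μ ν * lam ^ eta := by
    have h := hc μ ν p
    rwa [Real.norm_eq_abs, Real.norm_of_nonneg hpow] at h
  exact h2.trans (mul_le_mul_of_nonneg_right ((le_abs_self _).trans h1) hpow)

end
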